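/- Let (E,ℓ) be a complete separable metric space and fix 1 ≤ p < p'. Suppose K ⊂ P^p(P^p(E)) is such that the set of mean measures {mP : P ∈ K} ⊂ P(E) is tight and sup_{P∈K} ∫_E ℓ^{p'}(x,x_0) mP(dx) < ∞ for some x_0 ∈ E. Then K is relatively compact in P^p(P^p(E)). -/

import Mathlib

open MeasureTheory ProbabilityTheory Filter Topology
open scoped ENNReal

noncomputable section

namespace MFG

/-- Couplings of two measures. -/
def Couplings {E : Type*} [MeasurableSpace E] (μ ν : Measure E) : Set (Measure (E × E)) :=
  {γ | γ.map Prod.fst = μ ∧ γ.map Prod.snd = ν}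

/-- The `p`-Wasserstein distance associated with a ground (extended) distance `d`. -/
def WDist {E : Type*} [MeasurableSpace E] (p : ℝ) (d : E → E → ℝ≥0∞)
    (μ ν : Measure E) : ℝ≥0∞ :=
  ⨅ (γ : Measure (E × E)) (_ : γ ∈ Couplings μ ν), (∫⁻ z, d z.1 z.2 ^ p ∂γ) ^ (1 / p)

/-- Membership in the Wasserstein space `P^p(E)` (w.r.t. the ground distance `d`). -/
def MemPp {E : Type*} [MeasurableSpace E] (p : ℝ) (d : E → E → ℝ≥0∞) (μ : Measure E) : Prop :=
  IsProbabilityMeasure μ ∧ ∃ x₀ : E, ∫⁻ x, d x x₀ ^ p ∂μ ≠ ∞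

/-- Convergence in the `p`-Wasserstein distance. -/
def WTendsto {E : Type*} [MeasurableSpace E] (p : ℝ) (d : E → E → ℝ≥0∞)
    (μs : ℕ → Measure E) (μ : Measure E) : Prop :=
  Tendsto (fun n => WDist p d (μs n) μ) atTop (nhds 0)

/-- Sequential relative compactness of a family of measures in `P^p(E)`. -/
def WRelCompact {E : Type*} [MeasurableSpace E] (p : ℝ) (d : E → E → ℝ≥0∞)
    (S : Set (Measure E)) : Prop :=
  ∀ μs : ℕ → Measure E, (∀ n, μs n ∈ S) →
    ∃ (φ : ℕ → ℕ) (μ : Measure E), StrictMono φ ∧ MemPp p d μ ∧ WTendsto p d (μs ∘ φ) μ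

section WeakTopology

open TopologicalSpace

variable {X : Type*} [TopologicalSpace X] [MeasurableSpace X]

lemma isOpen_setOf_lt_measure [OpensMeasurableSpace X] [HasOuterApproxClosed X]
    {U : Set X} (hU : IsOpen U) (c : ℝ≥0∞) :
    IsOpen {μ : ProbabilityMeasure X | c < (μ : Measure X) U} := by
  refine isOpen_iff_mem_nhds.2 fun μ hμ ↦ ?_
  have h := ProbabilityMeasure.le_liminf_measure_open_of_tendsto (tendsto_id (x := 𝓝 μ)) hU
  exact eventually_lt_of_lt_liminf (lt_of_lt_of_le hμ h)

lemma exists_countable_measurable_subbasis [OpensMeasurableSpace X] [HasOuterApproxClosed X]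
    [SecondCountableTopology X] :
    ∃ S : Set (Set (ProbabilityMeasure X)), S.Countable ∧
      (inferInstance : TopologicalSpace (ProbabilityMeasure X)) = generateFrom S ∧
      ∀ s ∈ S, MeasurableSet s := by
  obtain ⟨b, hbc, -, hb⟩ := exists_countable_basis X
  let F : Set (Set (Set X)) := {T | T.Finite ∧ T ⊆ b}
  have hF : F.Countable := Set.countable_ofPred_finite_subset hbc
  have hopen : ∀ T ∈ F, IsOpen (⋃₀ T) := fun T hT ↦
    isOpen_sUnion fun s hs ↦ hb.isOpen (hT.2 hs)
  let S : Set (Set (ProbabilityMeasure X)) :=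
    (fun z : Set (Set X) × ℚ ↦ {μ | ENNReal.ofReal z.2 < (μ : Measure X) (⋃₀ z.1)}) ''
      (F ×ˢ Set.univ)
  have hS : S.Countable := (hF.prod Set.countable_univ).image _
  refine ⟨S, hS, le_antisymm ?_ ?_, ?_⟩
  · refine le_generateFrom ?_
    rintro _ ⟨⟨T, q⟩, ⟨hT, -⟩, rfl⟩
    exact isOpen_setOf_lt_measure (hopen T hT) _
  · refine le_of_nhds_le_nhds fun μ ↦ ?_
    have hsc : @SecondCountableTopology _ (generateFrom S) :=
      @SecondCountableTopology.mk' _ _ hS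
    have hcg : (@nhds _ (generateFrom S) μ).IsCountablyGenerated :=
      @FirstCountableTopology.nhds_generated_countable _ (generateFrom S)
        (@SecondCountableTopology.to_firstCountableTopology _ (generateFrom S) hsc) μ
    refine tendsto_of_forall_isOpen_le_liminf' (μs := fun ν ↦ ν)
      (L := @nhds _ (generateFrom S) μ) fun G hG ↦ ?_
    refine le_of_forall_lt fun c hc ↦ ?_
    let C : Set (Set (Set X)) := {T | T.Finite ∧ T ⊆ {s | s ∈ b ∧ s ⊆ G}}
    have hC : C.Countable :=
      Set.countable_ofPred_finite_subset (hbc.mono fun s hs ↦ hs.1)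
    have hGeq : G = ⋃ T ∈ C, ⋃₀ T := by
      refine Set.Subset.antisymm (fun x hx ↦ ?_) ?_
      · obtain ⟨s, hs, hxs, hsG⟩ := hb.exists_subset_of_mem_open hx hG
        refine Set.mem_biUnion (x := {s}) ⟨Set.finite_singleton s, ?_⟩ (by simpa using hxs)
        simpa using ⟨hs, hsG⟩
      · exact Set.iUnion₂_subset fun T hT ↦ Set.sUnion_subset fun s hs ↦ (hT.2 hs).2
    have hdir : DirectedOn (Function.onFun (· ⊆ ·) fun T : Set (Set X) ↦ ⋃₀ T) C := fun T hT T' hT' ↦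
      ⟨T ∪ T', ⟨hT.1.union hT'.1, Set.union_subset hT.2 hT'.2⟩,
        Set.sUnion_subset_sUnion Set.subset_union_left,
        Set.sUnion_subset_sUnion Set.subset_union_right⟩
    obtain ⟨T, hT, hcT⟩ : ∃ T ∈ C, c < (μ : Measure X) (⋃₀ T) := by
      rw [hGeq, measure_biUnion_eq_iSup hC hdir] at hc
      simpa only [lt_iSup_iff, exists_prop] using hc
    obtain ⟨q, -, hcq, hqT⟩ := ENNReal.lt_iff_exists_rat_btwn.1 hcT
    have hmem : {ν : ProbabilityMeasure X | ENNReal.ofReal q < (ν : Measure X) (⋃₀ T)} ∈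
        @nhds _ (generateFrom S) μ := by
      have hqμ : μ ∈ {ν : ProbabilityMeasure X | ENNReal.ofReal q < (ν : Measure X) (⋃₀ T)} := hqT
      refine @IsOpen.mem_nhds _ (generateFrom S) _ _ (isOpen_generateFrom_of_mem ?_) hqμ
      exact ⟨(T, q), ⟨⟨hT.1, fun s hs ↦ (hT.2 hs).1⟩, Set.mem_univ _⟩, rfl⟩
    refine hcq.trans_le (le_liminf_of_le (by isBoundedDefault) ?_)
    filter_upwards [hmem] with ν hν
    exact hν.le.trans (measure_mono (Set.sUnion_subset fun s hs ↦ (hT.2 hs).2))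
  · rintro _ ⟨⟨T, q⟩, ⟨hT, -⟩, rfl⟩
    exact ((Measure.measurable_coe (hopen T hT).measurableSet).comp
      measurable_subtype_coe) measurableSet_Ioi

instance [OpensMeasurableSpace X] [HasOuterApproxClosed X] [SecondCountableTopology X] :
    SecondCountableTopology (ProbabilityMeasure X) := by
  obtain ⟨S, hS, hSeq, -⟩ := exists_countable_measurable_subbasis (X := X)
  exact ⟨S, hS, hSeq⟩

instance [BorelSpace X] [HasOuterApproxClosed X] [SecondCountableTopology X] :
    BorelSpace (ProbabilityMeasure X) := by
  obtain ⟨S, hS, hSeq, hSm⟩ := exists_countable_measurable_subbasis (X := X)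
  refine ⟨le_antisymm ?_ ?_⟩
  · let m : MeasurableSpace (ProbabilityMeasure X) := borel _
    have : BorelSpace (ProbabilityMeasure X) := ⟨rfl⟩
    have h : Measurable fun μ : ProbabilityMeasure X ↦ (μ : Measure X) := by
      refine Measurable.measure_of_isPiSystem_of_isProbabilityMeasure
        (S := {s : Set X | IsOpen s}) (BorelSpace.measurable_eq) isPiSystem_isOpen fun s hs ↦ ?_
      exact measurable_of_Ioi fun c ↦ (isOpen_setOf_lt_measure hs c).measurableSet
    exact MeasurableSpace.comap_le_iff_le_map.2 h
  · rw [borel_eq_generateFrom_of_subbasis hSeq]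
    exact MeasurableSpace.generateFrom_le hSm

end WeakTopology

section Couplings

variable {X : Type*} [MeasurableSpace X]

/-- A measure whose marginals are dominated by `ν` and `ν'` extends to a coupling of them. -/
lemma exists_mem_couplings_measure_le (ν ν' : Measure X) [IsProbabilityMeasure ν]
    [IsProbabilityMeasure ν'] (γ₀ : Measure (X × X)) (h₁ : γ₀.map Prod.fst ≤ ν)
    (h₂ : γ₀.map Prod.snd ≤ ν') :
    ∃ γ ∈ Couplings ν ν', ∀ s, γ s ≤ γ₀ s + (1 - γ₀ Set.univ) := by
  set α := γ₀.map Prod.fst with hα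
  set β := γ₀.map Prod.snd with hβ
  have hα1 : α Set.univ = γ₀ Set.univ := by
    rw [hα, Measure.map_apply measurable_fst MeasurableSet.univ, Set.preimage_univ]
  have hβ1 : β Set.univ = γ₀ Set.univ := by
    rw [hβ, Measure.map_apply measurable_snd MeasurableSet.univ, Set.preimage_univ]
  have : IsFiniteMeasure α := isFiniteMeasure_of_le ν h₁
  have : IsFiniteMeasure β := isFiniteMeasure_of_le ν' h₂
  have hα2 : (ν - α) Set.univ = 1 - γ₀ Set.univ := by
    rw [Measure.sub_apply MeasurableSet.univ h₁, measure_univ, hα1]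
  have hβ2 : (ν' - β) Set.univ = 1 - γ₀ Set.univ := by
    rw [Measure.sub_apply MeasurableSet.univ h₂, measure_univ, hβ1]
  set r := 1 - γ₀ Set.univ with hr
  have hr_top : r ≠ ∞ := (tsub_le_self.trans_lt ENNReal.one_lt_top).ne
  have key : ∀ ρ : Measure X, ρ Set.univ = r → (r⁻¹ * r) • ρ = ρ := by
    intro ρ hρ
    by_cases h0 : r = 0
    · rw [Measure.measure_univ_eq_zero.1 (hρ.trans h0), smul_zero]
    · rw [ENNReal.inv_mul_cancel h0 hr_top, one_smul]
  refine ⟨γ₀ + r⁻¹ • (ν - α).prod (ν' - β), ⟨?_, ?_⟩, fun s ↦ ?_⟩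
  · rw [Measure.map_add _ _ measurable_fst, Measure.map_smul, Measure.map_fst_prod, hβ2,
      smul_smul, key _ hα2, ← hα, add_comm, Measure.sub_add_cancel_of_le h₁]
  · rw [Measure.map_add _ _ measurable_snd, Measure.map_smul, Measure.map_snd_prod, hα2,
      smul_smul, key _ hβ2, ← hβ, add_comm, Measure.sub_add_cancel_of_le h₂]
  · rw [Measure.add_apply, Measure.smul_apply, smul_eq_mul]
    gcongr
    calc r⁻¹ * ((ν - α).prod (ν' - β)) s
        ≤ r⁻¹ * ((ν - α).prod (ν' - β)) Set.univ := by gcongr; exact Set.subset_univ s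
      _ = r⁻¹ * r * r := by
        rw [← Set.univ_prod_univ, Measure.prod_prod, hα2, hβ2, mul_assoc]
      _ ≤ 1 * r := by gcongr; exact ENNReal.inv_mul_le_one r
      _ = r := one_mul r

/-- Two probability measures that almost agree on a partition admit a coupling that
concentrates on the corresponding diagonal blocks. -/
lemma exists_mem_couplings_blocks (ν ν' : Measure X) [IsProbabilityMeasure ν]
    [IsProbabilityMeasure ν'] {A : ℕ → Set X} (hA : ∀ i, MeasurableSet (A i))
    (hdisj : Pairwise (Function.onFun Disjoint A)) (k : ℕ) :
    ∃ γ ∈ Couplings ν ν', γ (⋃ i ∈ Finset.range k, A i ×ˢ A i)ᶜ ≤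
      1 - ∑ i ∈ Finset.range k, min (ν (A i)) (ν' (A i)) := by
  set m : ℕ → ℝ≥0∞ := fun i ↦ min (ν (A i)) (ν' (A i)) with hm
  let γ₀ : Measure (X × X) := ∑ i ∈ Finset.range k,
    (m i * (ν (A i))⁻¹ * (ν' (A i))⁻¹) • (ν.restrict (A i)).prod (ν'.restrict (A i))
  have hsum : ∀ (ρ : Measure X), ∑ i ∈ Finset.range k, ρ.restrict (A i) ≤ ρ := by
    intro ρ
    refine Measure.le_iff.2 fun s hs ↦ ?_
    rw [Measure.finsetSum_apply]
    calc ∑ i ∈ Finset.range k, ρ.restrict (A i) s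
        = ∑ i ∈ Finset.range k, ρ (s ∩ A i) :=
          Finset.sum_congr rfl fun i _ ↦ Measure.restrict_apply hs
      _ = ρ (⋃ i ∈ Finset.range k, s ∩ A i) := by
          rw [measure_biUnion_finset _ fun i _ ↦ hs.inter (hA i)]
          exact fun i _ j _ hij ↦ (hdisj hij).mono Set.inter_subset_right Set.inter_subset_right
      _ ≤ ρ s := measure_mono (Set.iUnion₂_subset fun i _ ↦ Set.inter_subset_left)
  have hcoef : ∀ a b : ℝ≥0∞, min a b * a⁻¹ * b⁻¹ * b ≤ 1 := fun a b ↦ by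
    calc min a b * a⁻¹ * b⁻¹ * b = (min a b * a⁻¹) * (b⁻¹ * b) := by rw [mul_assoc]
      _ ≤ (a * a⁻¹) * (b⁻¹ * b) := by gcongr; exact min_le_left _ _
      _ ≤ 1 * 1 := by
        gcongr
        · exact ENNReal.mul_inv_le_one a
        · exact ENNReal.inv_mul_le_one b
      _ = 1 := one_mul 1
  have hmass : ∀ i, m i * (ν (A i))⁻¹ * (ν' (A i))⁻¹ * (ν (A i) * ν' (A i)) = m i := by
    intro i
    by_cases h0 : m i = 0
    · simp [h0]
    · have h1 : ν (A i) ≠ 0 := fun h ↦ h0 (by simp [hm, h])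
      have h2 : ν' (A i) ≠ 0 := fun h ↦ h0 (by simp [hm, h])
      calc m i * (ν (A i))⁻¹ * (ν' (A i))⁻¹ * (ν (A i) * ν' (A i))
          = m i * ((ν (A i))⁻¹ * ν (A i)) * ((ν' (A i))⁻¹ * ν' (A i)) := by ring
        _ = m i := by
          rw [ENNReal.inv_mul_cancel h1 (measure_ne_top _ _),
            ENNReal.inv_mul_cancel h2 (measure_ne_top _ _), mul_one, mul_one]
  have huniv : γ₀ Set.univ = ∑ i ∈ Finset.range k, m i := by
    simp only [γ₀, Measure.finsetSum_apply, Measure.smul_apply, smul_eq_mul]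
    refine Finset.sum_congr rfl fun i _ ↦ ?_
    rw [← Set.univ_prod_univ, Measure.prod_prod, Measure.restrict_apply_univ,
      Measure.restrict_apply_univ, hmass]
  have hmap : ∀ f : X × X → X, Measurable f → γ₀.map f = ∑ i ∈ Finset.range k,
      (m i * (ν (A i))⁻¹ * (ν' (A i))⁻¹) •
        ((ν.restrict (A i)).prod (ν'.restrict (A i))).map f := by
    intro f hf
    simp only [γ₀, ← Measure.mapₗ_apply_of_measurable hf, map_sum, map_smul]
  have h₁ : γ₀.map Prod.fst ≤ ν := by
    rw [hmap _ measurable_fst]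
    refine (Finset.sum_le_sum fun i _ ↦ ?_).trans (hsum ν)
    rw [Measure.map_fst_prod, smul_smul, Measure.restrict_apply_univ]
    exact Measure.le_iff.2 fun s _ ↦ (mul_le_mul_left (hcoef _ _) _).trans_eq (one_mul _)
  have h₂ : γ₀.map Prod.snd ≤ ν' := by
    rw [hmap _ measurable_snd]
    refine (Finset.sum_le_sum fun i _ ↦ ?_).trans (hsum ν')
    rw [Measure.map_snd_prod, smul_smul, Measure.restrict_apply_univ]
    have := hcoef (ν' (A i)) (ν (A i))
    rw [min_comm, mul_right_comm (min _ _)] at this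
    exact Measure.le_iff.2 fun s _ ↦ (mul_le_mul_left this _).trans_eq (one_mul _)
  obtain ⟨γ, hγ, hle⟩ := exists_mem_couplings_measure_le ν ν' γ₀ h₁ h₂
  refine ⟨γ, hγ, (hle _).trans_eq ?_⟩
  rw [huniv]
  suffices γ₀ (⋃ i ∈ Finset.range k, A i ×ˢ A i)ᶜ = 0 by rw [this, zero_add]
  simp only [γ₀, Measure.finsetSum_apply, Measure.smul_apply, smul_eq_mul]
  refine Finset.sum_eq_zero fun i hi ↦ ?_
  rw [Measure.prod_restrict, Measure.restrict_apply']
  · have : (⋃ i ∈ Finset.range k, A i ×ˢ A i)ᶜ ∩ A i ×ˢ A i = ∅ := by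
      rw [← Set.disjoint_iff_inter_eq_empty, Set.disjoint_compl_left_iff_subset]
      exact Set.subset_biUnion_of_mem (u := fun i ↦ A i ×ˢ A i) hi
    rw [this, measure_empty, mul_zero]
  · exact (hA i).prod (hA i)

end Couplings

section BlockCouplings

open TopologicalSpace

lemma measure_frontier_diff_eq_zero {X : Type*} [TopologicalSpace X] [MeasurableSpace X]
    {μ : Measure X} {s t : Set X} (hs : μ (frontier s) = 0)
    (ht : μ (frontier t) = 0) : μ (frontier (s \ t)) = 0 := by
  refine measure_mono_null (t := frontier s ∪ frontier t) ?_ (measure_union_null hs ht)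
  rw [Set.sdiff_eq]
  refine (frontier_inter_subset s tᶜ).trans ?_
  rw [frontier_compl]
  exact Set.union_subset_union Set.inter_subset_left Set.inter_subset_right

variable {X : Type*} [TopologicalSpace X] [PseudoMetrizableSpace X] [MeasurableSpace X]
  [BorelSpace X]

lemma exists_open_null_frontier (μ : Measure X) [SFinite μ] {x : X} {V : Set X} (hV : V ∈ 𝓝 x) :
    ∃ U, IsOpen U ∧ x ∈ U ∧ U ⊆ V ∧ μ (frontier U) = 0 := by
  let _ := pseudoMetrizableSpacePseudoMetric X
  obtain ⟨r, hr, hrV⟩ := Metric.mem_nhds_iff.1 hV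
  obtain ⟨s, hs, hs0⟩ := exists_null_frontier_thickening μ {x} hr
  rw [Metric.thickening_singleton] at hs0
  exact ⟨Metric.ball x s, Metric.isOpen_ball, Metric.mem_ball_self hs.1,
    (Metric.ball_subset_ball hs.2.le).trans hrV, hs0⟩

/-- Measures that are weakly close can be coupled so that, up to small probability, the two
coordinates lie in a common prescribed neighbourhood. -/
lemma exists_nhds_forall_exists_coupling [SecondCountableTopology X]
    (μ : ProbabilityMeasure X) {V : X → Set X}
    (hV : ∀ x, V x ∈ 𝓝 x) {δ : ℝ≥0∞} (hδ : δ ≠ 0) :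
    ∃ S : Set (X × X), MeasurableSet S ∧ (∀ z ∈ S, ∃ x, z.1 ∈ V x ∧ z.2 ∈ V x) ∧
      ∃ W ∈ 𝓝 μ, ∀ ν ∈ W, ∀ ν' ∈ W,
        ∃ γ ∈ Couplings (ν : Measure X) (ν' : Measure X), γ Sᶜ ≤ δ := by
  choose U hUo hxU hUV hU0 using fun x ↦ exists_open_null_frontier (μ : Measure X) (hV x)
  obtain ⟨s, hs, hsU⟩ := TopologicalSpace.countable_cover_nhds fun x ↦ (hUo x).mem_nhds (hxU x)
  have hne : s.Nonempty := by
    obtain ⟨x⟩ := μ.nonempty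
    obtain ⟨y, hy, -⟩ := Set.mem_iUnion₂.1 (hsU ▸ Set.mem_univ x)
    exact ⟨y, hy⟩
  obtain ⟨e, rfl⟩ := hs.exists_eq_range hne
  rw [Set.biUnion_range] at hsU
  let A : ℕ → Set X := disjointed fun i ↦ U (e i)
  have hA : ∀ i, MeasurableSet (A i) :=
    MeasurableSet.disjointed fun i ↦ (hUo (e i)).measurableSet
  have hA0 : ∀ i, (μ : Measure X) (frontier (A i)) = 0 := fun i ↦
    disjointedRec (p := fun t ↦ (μ : Measure X) (frontier t) = 0)
      (fun t j ht ↦ measure_frontier_diff_eq_zero ht (hU0 (e j))) (hU0 (e i))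
  have hdisj : Pairwise (Function.onFun Disjoint A) := disjoint_disjointed _
  have htsum : ∑' i, (μ : Measure X) (A i) = 1 := by
    rw [← measure_iUnion hdisj hA, iUnion_disjointed, hsU, measure_univ]
  have hδ2 : δ / 2 ≠ 0 := by simpa using hδ
  obtain ⟨k, hk⟩ : ∃ k, 1 ≤ ∑ i ∈ Finset.range k, (μ : Measure X) (A i) + δ / 2 := by
    have h := (ENNReal.summable (f := fun i ↦ (μ : Measure X) (A i))).hasSum.tendsto_sum_nat
    rw [htsum] at h
    have h' := h.add_const (δ / 2)
    obtain ⟨k, hk⟩ := ((tendsto_order.1 h').1 1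
      (ENNReal.lt_add_right ENNReal.one_ne_top hδ2)).exists
    exact ⟨k, hk.le⟩
  obtain ⟨η, hη0, hη⟩ : ∃ η : ℝ≥0∞, η ≠ 0 ∧ k * η ≤ δ / 2 :=
    ⟨δ / 2 / k, (ENNReal.div_pos hδ2 (ENNReal.natCast_ne_top k)).ne', ENNReal.mul_div_le⟩
  have hev : ∀ i ∈ Finset.range k, ∀ᶠ ν : ProbabilityMeasure X in 𝓝 μ,
      (μ : Measure X) (A i) ≤ (ν : Measure X) (A i) + η := fun i _ ↦ by
    have h := (ProbabilityMeasure.tendsto_measure_of_null_frontier_of_tendsto'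
      (tendsto_id (x := 𝓝 μ)) (hA0 i)).add_const η
    by_cases hi : (μ : Measure X) (A i) = 0
    · simp [hi]
    · filter_upwards [(tendsto_order.1 h).1 ((μ : Measure X) (A i))
        (ENNReal.lt_add_right (measure_ne_top _ _) hη0)] with ν hν using hν.le
  refine ⟨⋃ i ∈ Finset.range k, A i ×ˢ A i,
    Finset.measurableSet_biUnion _ fun i _ ↦ (hA i).prod (hA i), fun z hz ↦ ?_, _,
    (Filter.eventually_all_finset _).2 hev, fun ν hν ν' hν' ↦ ?_⟩
  · obtain ⟨i, -, hi⟩ := Set.mem_iUnion₂.1 hz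
    exact ⟨e i, hUV _ (disjointed_subset (fun i ↦ U (e i)) i hi.1),
      hUV _ (disjointed_subset (fun i ↦ U (e i)) i hi.2)⟩
  · obtain ⟨γ, hγ, hle⟩ := exists_mem_couplings_blocks (ν : Measure X) (ν' : Measure X) hA hdisj k
    refine ⟨γ, hγ, hle.trans (tsub_le_iff_left.2 (hk.trans ?_))⟩
    calc ∑ i ∈ Finset.range k, (μ : Measure X) (A i) + δ / 2
        ≤ ∑ i ∈ Finset.range k, (min ((ν : Measure X) (A i)) ((ν' : Measure X) (A i)) + η)
          + δ / 2 := by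
          gcongr with i hi
          rw [← min_add_add_right]
          exact le_min (hν i hi) (hν' i hi)
      _ = ∑ i ∈ Finset.range k, min ((ν : Measure X) (A i)) ((ν' : Measure X) (A i))
          + (k * η + δ / 2) := by
          rw [Finset.sum_add_distrib, Finset.sum_const, Finset.card_range, nsmul_eq_mul, add_assoc]
      _ ≤ ∑ i ∈ Finset.range k, min ((ν : Measure X) (A i)) ((ν' : Measure X) (A i)) + δ := by
          gcongr
          calc k * η + δ / 2 ≤ δ / 2 + δ / 2 := by gcongr
            _ = δ := ENNReal.add_halves δ

end BlockCouplings

section Cost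

variable {X : Type*} [MeasurableSpace X]

lemma isProbabilityMeasure_of_mem_couplings {ν ν' : Measure X} [IsProbabilityMeasure ν]
    {γ : Measure (X × X)} (hγ : γ ∈ Couplings ν ν') : IsProbabilityMeasure γ := by
  refine ⟨?_⟩
  rw [← measure_univ (μ := ν), ← hγ.1, Measure.map_apply measurable_fst MeasurableSet.univ,
    Set.preimage_univ]

lemma prod_mem_couplings (ν ν' : Measure X) [IsProbabilityMeasure ν] [IsProbabilityMeasure ν'] :
    ν.prod ν' ∈ Couplings ν ν' := by
  constructor
  · rw [Measure.map_fst_prod, measure_univ, one_smul]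
  · rw [Measure.map_snd_prod, measure_univ, one_smul]

lemma WDist_le_of_lintegral_le {p : ℝ} (hp : 0 < p) {d : X → X → ℝ≥0∞} {ν ν' : Measure X}
    {γ : Measure (X × X)} (hγ : γ ∈ Couplings ν ν') {ε : ℝ≥0∞}
    (h : ∫⁻ z, d z.1 z.2 ^ p ∂γ ≤ ε ^ p) : WDist p d ν ν' ≤ ε := by
  refine (iInf₂_le γ hγ).trans ?_
  rw [one_div, ENNReal.rpow_inv_le_iff hp]
  exact h

lemma setLIntegral_le_rpow_mul_rpow (μ : Measure X) {h : X → ℝ≥0∞} (hh : Measurable h) {q : ℝ}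
    (hq : 1 < q) (B : Set X) :
    ∫⁻ x in B, h x ∂μ ≤ (∫⁻ x, h x ^ q ∂μ) ^ (1 / q) * μ B ^ (1 - 1 / q) := by
  have hc := Real.HolderConjugate.conjExponent hq
  have key := ENNReal.lintegral_mul_le_Lp_mul_Lq (μ.restrict B) hc hh.aemeasurable
    (aemeasurable_const (b := (1 : ℝ≥0∞)))
  have he : 1 / q.conjExponent = 1 - 1 / q := by
    have := hc.inv_add_inv_eq_one
    rw [one_div, one_div]
    linarith
  simp only [Pi.mul_apply, mul_one, ENNReal.one_rpow, lintegral_one,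
    Measure.restrict_apply_univ, he] at key
  refine key.trans ?_
  have hq0 : 0 ≤ 1 / q := div_nonneg zero_le_one (by linarith)
  gcongr
  exact Measure.restrict_le_self

lemma lintegral_rpow_le_lintegral_rpow (μ : Measure X) [IsProbabilityMeasure μ] {h : X → ℝ≥0∞}
    (hh : Measurable h) {q : ℝ} (hq : 1 < q) : (∫⁻ x, h x ∂μ) ^ q ≤ ∫⁻ x, h x ^ q ∂μ := by
  have key := setLIntegral_le_rpow_mul_rpow μ hh hq Set.univ
  rw [Measure.restrict_univ, measure_univ, ENNReal.one_rpow, mul_one, one_div] at key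
  exact (ENNReal.le_rpow_inv_iff (by linarith)).1 key

lemma lintegral_coupling_le {ν ν' : Measure X} [IsProbabilityMeasure ν] {γ : Measure (X × X)}
    (hγ : γ ∈ Couplings ν ν') {h : X → ℝ≥0∞} (hh : Measurable h) {q : ℝ} (hq : 1 < q)
    {M c η : ℝ≥0∞} (hM : ∫⁻ x, h x ^ q ∂ν ≤ M) (hM' : ∫⁻ x, h x ^ q ∂ν' ≤ M)
    {D : X × X → ℝ≥0∞} (hD : ∀ z, D z ≤ c * (h z.1 + h z.2)) {S : Set (X × X)}
    (hS : MeasurableSet S) (hDS : ∀ z ∈ S, D z ≤ η) :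
    ∫⁻ z, D z ∂γ ≤ η + c * (2 * (M ^ (1 / q) * γ Sᶜ ^ (1 - 1 / q))) := by
  have := isProbabilityMeasure_of_mem_couplings hγ
  have hq0 : 0 ≤ 1 / q := div_nonneg zero_le_one (by linarith)
  have hf : ∫⁻ z in Sᶜ, h z.1 ∂γ ≤ M ^ (1 / q) * γ Sᶜ ^ (1 - 1 / q) := by
    refine (setLIntegral_le_rpow_mul_rpow γ (hh.comp measurable_fst) hq Sᶜ).trans ?_
    gcongr
    refine Eq.trans_le ?_ hM
    rw [← hγ.1, lintegral_map (hh.pow_const q) measurable_fst]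
    rfl
  have hs : ∫⁻ z in Sᶜ, h z.2 ∂γ ≤ M ^ (1 / q) * γ Sᶜ ^ (1 - 1 / q) := by
    refine (setLIntegral_le_rpow_mul_rpow γ (hh.comp measurable_snd) hq Sᶜ).trans ?_
    gcongr
    refine Eq.trans_le ?_ hM'
    rw [← hγ.2, lintegral_map (hh.pow_const q) measurable_snd]
    rfl
  rw [← lintegral_add_compl D hS]
  refine add_le_add ?_ ?_
  · calc ∫⁻ z in S, D z ∂γ ≤ ∫⁻ _ in S, η ∂γ := setLIntegral_mono' hS hDS
      _ = η * γ S := setLIntegral_const S η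
      _ ≤ η := mul_le_of_le_one_right' prob_le_one
  · calc ∫⁻ z in Sᶜ, D z ∂γ ≤ ∫⁻ z in Sᶜ, c * (h z.1 + h z.2) ∂γ := lintegral_mono hD
      _ = c * (∫⁻ z in Sᶜ, h z.1 ∂γ + ∫⁻ z in Sᶜ, h z.2 ∂γ) := by
        have h1 : Measurable fun z : X × X ↦ h z.1 := hh.comp measurable_fst
        have h2 : Measurable fun z : X × X ↦ h z.2 := hh.comp measurable_snd
        have h12 : Measurable fun z : X × X ↦ h z.1 + h z.2 := h1.add h2
        rw [lintegral_const_mul c h12, lintegral_add_left h1]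
      _ ≤ c * (2 * (M ^ (1 / q) * γ Sᶜ ^ (1 - 1 / q))) := by
        rw [two_mul]
        gcongr

lemma exists_ne_zero_mul_rpow_le {q : ℝ} (hq : 1 < q) {M c η : ℝ≥0∞} (hM : M ≠ ∞) (hc : c ≠ ∞)
    (hη : η ≠ 0) :
    ∃ δ : ℝ≥0∞, δ ≠ 0 ∧ δ ≠ ∞ ∧ c * (2 * (M ^ (1 / q) * δ ^ (1 - 1 / q))) ≤ η := by
  have hq' : 0 < 1 - 1 / q := sub_pos.2 ((div_lt_one (by linarith)).2 hq)
  have hMq : M ^ (1 / q) ≠ ∞ := ENNReal.rpow_ne_top_of_nonneg (by positivity) hM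
  have hcont : Continuous fun δ : ℝ≥0∞ ↦ c * (2 * (M ^ (1 / q) * δ ^ (1 - 1 / q))) :=
    (ENNReal.continuous_const_mul hc).comp ((ENNReal.continuous_const_mul ENNReal.ofNat_ne_top).comp
      ((ENNReal.continuous_const_mul hMq).comp ENNReal.continuous_rpow_const))
  have h0 := hcont.tendsto 0
  simp only [ENNReal.zero_rpow_of_pos hq', mul_zero] at h0
  have hev := (((tendsto_order.1 h0).2 η (pos_iff_ne_zero.2 hη)).and
    (gt_mem_nhds (zero_lt_one (α := ℝ≥0∞)))).filter_mono (nhdsWithin_le_nhds (s := Set.Ioi 0))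
  obtain ⟨δ, ⟨hδ, hδ1⟩, hδ0⟩ := (hev.and self_mem_nhdsWithin).exists
  exact ⟨δ, (Set.mem_Ioi.1 hδ0).ne', (hδ1.trans ENNReal.one_lt_top).ne, hδ.le⟩

end Cost

section Moments

lemma lintegral_iSup_le_of_tendsto {X : Type*} [TopologicalSpace X] [MeasurableSpace X]
    [OpensMeasurableSpace X] {P : ℕ → ProbabilityMeasure X} {Q : ProbabilityMeasure X}
    (hPQ : Tendsto P atTop (𝓝 Q)) {g : ℕ → BoundedContinuousFunction X NNReal}
    (hg : ∀ x, Monotone fun N ↦ g N x)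
    {M : ℝ≥0∞} (hM : ∀ n, ∫⁻ x, ⨆ N, (g N x : ℝ≥0∞) ∂(P n : Measure X) ≤ M) :
    ∫⁻ x, ⨆ N, (g N x : ℝ≥0∞) ∂(Q : Measure X) ≤ M := by
  rw [lintegral_iSup (fun N ↦ (g N).continuous.measurable.coe_nnreal_ennreal)
    (fun N N' h x ↦ ENNReal.coe_le_coe.2 (hg x h))]
  refine iSup_le fun N ↦ ?_
  refine le_of_tendsto' (ProbabilityMeasure.tendsto_iff_forall_lintegral_tendsto.1 hPQ (g N))
    fun n ↦ ?_
  exact (lintegral_mono fun x ↦ le_iSup (fun N ↦ (g N x : ℝ≥0∞)) N).trans (hM n)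

/-- The truncation at level `N` of the function `x ↦ dist x x₀ ^ r`. -/
def truncDistPow {E : Type*} [PseudoMetricSpace E] (x₀ : E) {r : ℝ} (hr : 0 ≤ r) (N : ℕ) :
    BoundedContinuousFunction E NNReal :=
  BoundedContinuousFunction.mkOfBound
    ⟨fun x ↦ min (N : NNReal) (nndist x x₀ ^ r),
      continuous_const.min ((NNReal.continuous_rpow_const hr).comp
        (continuous_id.nndist continuous_const))⟩ N
    fun x y ↦ by
      have h : ∀ z : E, min (N : NNReal) (nndist z x₀ ^ r) ≤ N := fun z ↦ min_le_left _ _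
      rw [NNReal.dist_eq, abs_le]
      have h1 := NNReal.coe_le_coe.2 (h x)
      have h2 := NNReal.coe_le_coe.2 (h y)
      have h3 := NNReal.coe_nonneg (min (N : NNReal) (nndist x x₀ ^ r))
      have h4 := NNReal.coe_nonneg (min (N : NNReal) (nndist y x₀ ^ r))
      simp only [ContinuousMap.coe_mk, NNReal.coe_natCast] at *
      constructor <;> linarith

variable {E : Type*} [PseudoMetricSpace E]

lemma truncDistPow_apply (x₀ : E) {r : ℝ} (hr : 0 ≤ r) (N : ℕ) (x : E) :
    truncDistPow x₀ hr N x = min (N : NNReal) (nndist x x₀ ^ r) := rfl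

lemma monotone_truncDistPow (x₀ : E) {r : ℝ} (hr : 0 ≤ r) (x : E) :
    Monotone fun N ↦ truncDistPow x₀ hr N x :=
  fun _ _ h ↦ min_le_min_right _ (Nat.cast_le.2 h)

lemma iSup_truncDistPow (x₀ : E) {r : ℝ} (hr : 0 ≤ r) (x : E) :
    ⨆ N, (truncDistPow x₀ hr N x : ℝ≥0∞) = edist x x₀ ^ r := by
  rw [edist_nndist, ← ENNReal.coe_rpow_of_nonneg _ hr]
  refine le_antisymm (iSup_le fun N ↦ ENNReal.coe_le_coe.2 (min_le_right _ _)) ?_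
  obtain ⟨N, hN⟩ := exists_nat_ge (nndist x x₀ ^ r)
  refine le_iSup_of_le N (ENNReal.coe_le_coe.2 ?_)
  rw [truncDistPow_apply, min_eq_right hN]

variable [MeasurableSpace E] [OpensMeasurableSpace E]

/-- Integration of the truncated power of the distance, as a function on probability measures. -/
def truncMoment (x₀ : E) {r : ℝ} (hr : 0 ≤ r) (N : ℕ) :
    BoundedContinuousFunction (ProbabilityMeasure E) NNReal :=
  BoundedContinuousFunction.mkOfBound
    ⟨fun μ ↦ μ.toFiniteMeasure.testAgainstNN (truncDistPow x₀ hr N),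
      ProbabilityMeasure.continuous_testAgainstNN_eval _⟩ N
    fun μ ν ↦ by
      have h : ∀ ρ : ProbabilityMeasure E,
          ρ.toFiniteMeasure.testAgainstNN (truncDistPow x₀ hr N) ≤ N := fun ρ ↦ by
        rw [← ENNReal.coe_le_coe, FiniteMeasure.testAgainstNN_coe_eq]
        calc ∫⁻ x, (truncDistPow x₀ hr N x : ℝ≥0∞) ∂(ρ : Measure E)
            ≤ ∫⁻ _, ((N : NNReal) : ℝ≥0∞) ∂(ρ : Measure E) :=
              lintegral_mono fun x ↦ ENNReal.coe_le_coe.2 (min_le_left _ _)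
          _ = ((N : NNReal) : ℝ≥0∞) := by rw [lintegral_const, measure_univ, mul_one]
      rw [NNReal.dist_eq, abs_le]
      have h1 := NNReal.coe_le_coe.2 (h μ)
      have h2 := NNReal.coe_le_coe.2 (h ν)
      have h3 := NNReal.coe_nonneg (μ.toFiniteMeasure.testAgainstNN (truncDistPow x₀ hr N))
      have h4 := NNReal.coe_nonneg (ν.toFiniteMeasure.testAgainstNN (truncDistPow x₀ hr N))
      simp only [ContinuousMap.coe_mk, NNReal.coe_natCast] at *
      constructor <;> linarith

lemma coe_truncMoment_apply (x₀ : E) {r : ℝ} (hr : 0 ≤ r) (N : ℕ) (μ : ProbabilityMeasure E) :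
    (truncMoment x₀ hr N μ : ℝ≥0∞) =
      ∫⁻ x, (truncDistPow x₀ hr N x : ℝ≥0∞) ∂(μ : Measure E) :=
  FiniteMeasure.testAgainstNN_coe_eq

lemma monotone_truncMoment (x₀ : E) {r : ℝ} (hr : 0 ≤ r) (μ : ProbabilityMeasure E) :
    Monotone fun N ↦ truncMoment x₀ hr N μ :=
  fun N N' h ↦ by
    show truncMoment x₀ hr N μ ≤ truncMoment x₀ hr N' μ
    rw [← ENNReal.coe_le_coe, coe_truncMoment_apply, coe_truncMoment_apply]
    exact lintegral_mono fun x ↦ ENNReal.coe_le_coe.2 (monotone_truncDistPow x₀ hr x h)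

lemma iSup_truncMoment (x₀ : E) {r : ℝ} (hr : 0 ≤ r) (μ : ProbabilityMeasure E) :
    ⨆ N, (truncMoment x₀ hr N μ : ℝ≥0∞) = ∫⁻ x, edist x x₀ ^ r ∂(μ : Measure E) := by
  simp only [coe_truncMoment_apply, ← iSup_truncDistPow x₀ hr]
  exact (lintegral_iSup
    (fun N ↦ (truncDistPow x₀ hr N).continuous.measurable.coe_nnreal_ennreal)
    (fun N N' h x ↦ ENNReal.coe_le_coe.2 (monotone_truncDistPow x₀ hr x h))).symm

lemma lintegral_moment_le_of_tendsto [OpensMeasurableSpace (ProbabilityMeasure E)] (x₀ : E)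
    {r : ℝ} (hr : 0 ≤ r) {P : ℕ → ProbabilityMeasure (ProbabilityMeasure E)}
    {Q : ProbabilityMeasure (ProbabilityMeasure E)} (hPQ : Tendsto P atTop (𝓝 Q)) {M : ℝ≥0∞}
    (hM : ∀ n, ∫⁻ μ, ∫⁻ x, edist x x₀ ^ r ∂(μ : Measure E)
      ∂(P n : Measure (ProbabilityMeasure E)) ≤ M) :
    ∫⁻ μ, ∫⁻ x, edist x x₀ ^ r ∂(μ : Measure E) ∂(Q : Measure (ProbabilityMeasure E)) ≤ M := by
  simp only [← iSup_truncMoment x₀ hr] at hM ⊢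
  exact lintegral_iSup_le_of_tendsto hPQ (monotone_truncMoment x₀ hr) hM

end Moments

section Close

lemma WDist_rpow_le_of_mem_couplings {X : Type*} [MeasurableSpace X] {p : ℝ} (hp : 0 < p)
    (d : X → X → ℝ≥0∞) {ν ν' : Measure X} {γ : Measure (X × X)} (hγ : γ ∈ Couplings ν ν') :
    WDist p d ν ν' ^ p ≤ ∫⁻ z, d z.1 z.2 ^ p ∂γ := by
  rw [← ENNReal.le_rpow_inv_iff hp]
  exact WDist_le_of_lintegral_le hp hγ (by rw [ENNReal.rpow_inv_rpow hp.ne'])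

/-- Weakly close measures with uniformly bounded integrals of a superlinear majorant `H` of `h` can
be coupled at small cost, provided the cost is dominated by `h` and locally small on the sublevel
sets of `H`. -/
lemma exists_nhds_forall_exists_coupling_lintegral_le {X : Type*} [TopologicalSpace X]
    [TopologicalSpace.PseudoMetrizableSpace X] [MeasurableSpace X] [BorelSpace X]
    [SecondCountableTopology X] (μ : ProbabilityMeasure X) {D : X × X → ℝ≥0∞} {h H : X → ℝ≥0∞}
    (hh : Measurable h) (hH : Measurable H) {q : ℝ} (hq : 1 < q) (hhH : ∀ x, h x ^ q ≤ H x)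
    {c M η : ℝ≥0∞} (hc : c ≠ ∞) (hM : M ≠ ∞) (hη : η ≠ 0)
    (hD : ∀ z, D z ≤ c * (h z.1 + h z.2))
    (hloc : ∀ R ≠ ∞, ∀ x, ∃ V ∈ 𝓝 x, ∀ y ∈ V, ∀ z ∈ V, H y ≤ R → H z ≤ R → D (y, z) ≤ η) :
    ∃ W ∈ 𝓝 μ, ∀ ν ∈ W, ∀ ν' ∈ W, ∫⁻ x, H x ∂(ν : Measure X) ≤ M →
      ∫⁻ x, H x ∂(ν' : Measure X) ≤ M →
      ∃ γ ∈ Couplings (ν : Measure X) (ν' : Measure X), ∫⁻ z, D z ∂γ ≤ η + η := by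
  obtain ⟨δ, hδ0, hδt, hδ⟩ := exists_ne_zero_mul_rpow_le hq hM hc hη
  have hδ4 : δ / 2 / 2 ≠ 0 := by simp [hδ0]
  have hδ4t : δ / 2 / 2 ≠ ∞ := ENNReal.div_ne_top (ENNReal.div_ne_top hδt (by simp)) (by simp)
  set R := M / (δ / 2 / 2) + 1 with hR
  have hR0 : R ≠ 0 := by simp [hR]
  have hRt : R ≠ ∞ := ENNReal.add_ne_top.2 ⟨ENNReal.div_ne_top hM hδ4, ENNReal.one_ne_top⟩
  choose V hV hVD using hloc R hRt
  obtain ⟨S, hS, hSV, W, hW, hWγ⟩ := exists_nhds_forall_exists_coupling μ hV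
    (δ := δ / 2) (by simp [hδ0])
  refine ⟨W, hW, fun ν hν ν' hν' hνM hν'M ↦ ?_⟩
  obtain ⟨γ, hγ, hγS⟩ := hWγ ν hν ν' hν'
  refine ⟨γ, hγ, ?_⟩
  have hmark : ∀ ρ : ProbabilityMeasure X, ∫⁻ x, H x ∂(ρ : Measure X) ≤ M →
      (ρ : Measure X) {x | R ≤ H x} ≤ δ / 2 / 2 := by
    intro ρ hρ
    refine (meas_ge_le_lintegral_div hH.aemeasurable hR0 hRt).trans ?_
    refine ENNReal.div_le_of_le_mul ?_
    calc _ ≤ M := hρ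
      _ = δ / 2 / 2 * (M / (δ / 2 / 2)) := (ENNReal.mul_div_cancel hδ4 hδ4t).symm
      _ ≤ δ / 2 / 2 * R := by gcongr; exact le_self_add
  have hG : MeasurableSet {x | H x < R} := measurableSet_lt hH measurable_const
  have hB : MeasurableSet {x | R ≤ H x} := measurableSet_le measurable_const hH
  have hS' : MeasurableSet (S ∩ {x | H x < R} ×ˢ {x | H x < R}) := hS.inter (hG.prod hG)
  have hγS' : γ (S ∩ {x | H x < R} ×ˢ {x | H x < R})ᶜ ≤ δ := by
    calc γ (S ∩ {x | H x < R} ×ˢ {x | H x < R})ᶜ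
        ≤ γ (Sᶜ ∪ (Prod.fst ⁻¹' {x | R ≤ H x} ∪ Prod.snd ⁻¹' {x | R ≤ H x})) := by
          refine measure_mono fun z hz ↦ ?_
          simp only [Set.mem_compl_iff, Set.mem_inter_iff, Set.mem_prod, Set.mem_ofPred_eq,
            Set.mem_union, Set.mem_preimage] at hz ⊢
          by_contra! hcon
          exact hz ⟨hcon.1, hcon.2.1, hcon.2.2⟩
      _ ≤ γ Sᶜ + (γ (Prod.fst ⁻¹' {x | R ≤ H x}) + γ (Prod.snd ⁻¹' {x | R ≤ H x})) :=
          (measure_union_le _ _).trans (add_le_add_right (measure_union_le _ _) _)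
      _ ≤ δ / 2 + (δ / 2 / 2 + δ / 2 / 2) := by
          rw [← Measure.map_apply measurable_fst hB, ← Measure.map_apply measurable_snd hB,
            hγ.1, hγ.2]
          exact add_le_add hγS (add_le_add (hmark ν hνM) (hmark ν' hν'M))
      _ = δ := by rw [ENNReal.add_halves, ENNReal.add_halves]
  have hq' : 0 ≤ 1 - 1 / q := sub_nonneg.2 ((div_le_one (by linarith)).2 hq.le)
  refine (lintegral_coupling_le hγ hh hq ((lintegral_mono hhH).trans hνM)
    ((lintegral_mono hhH).trans hν'M) hD hS' (η := η) ?_).trans ?_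
  · rintro ⟨y, z⟩ ⟨hyz, hy, hz⟩
    obtain ⟨x, hx, hx'⟩ := hSV _ hyz
    exact hVD x y hx z hx' (le_of_lt hy) (le_of_lt hz)
  · gcongr
    refine le_trans ?_ hδ
    gcongr

lemma edist_rpow_le {E : Type*} [PseudoMetricSpace E] (x₀ : E) {p : ℝ} (hp : 1 ≤ p)
    (x y : E) :
    edist x y ^ p ≤ 2 ^ (p - 1) * (edist x x₀ ^ p + edist y x₀ ^ p) :=
  (ENNReal.rpow_le_rpow (edist_triangle_right x y x₀) (by linarith)).trans
    (ENNReal.rpow_add_le_mul_rpow_add_rpow _ _ hp)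

variable {E : Type*} [PseudoMetricSpace E] [MeasurableSpace E] [BorelSpace E]

lemma measurable_edist_rpow (x₀ : E) (r : ℝ) : Measurable fun x : E ↦ edist x x₀ ^ r :=
  (continuous_id.edist continuous_const).measurable.pow_const r

lemma measurable_moment (x₀ : E) (r : ℝ) :
    Measurable fun μ : ProbabilityMeasure E ↦ ∫⁻ x, edist x x₀ ^ r ∂(μ : Measure E) :=
  (Measure.measurable_lintegral (measurable_edist_rpow x₀ r)).comp measurable_subtype_coe

lemma WDist_rpow_le (x₀ : E) {p : ℝ} (hp : 1 ≤ p) (ν ν' : Measure E)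
    [IsProbabilityMeasure ν] [IsProbabilityMeasure ν'] :
    WDist p edist ν ν' ^ p ≤
      2 ^ (p - 1) * (∫⁻ x, edist x x₀ ^ p ∂ν + ∫⁻ x, edist x x₀ ^ p ∂ν') := by
  have h1 := measurable_edist_rpow x₀ p
  have h2 : Measurable fun z : E × E ↦ edist z.1 x₀ ^ p := h1.comp measurable_fst
  have h3 : Measurable fun z : E × E ↦ edist z.2 x₀ ^ p := h1.comp measurable_snd
  have h4 : Measurable fun z : E × E ↦ edist z.1 x₀ ^ p + edist z.2 x₀ ^ p := h2.add h3
  have hγ := prod_mem_couplings ν ν'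
  calc WDist p edist ν ν' ^ p ≤ ∫⁻ z, edist z.1 z.2 ^ p ∂(ν.prod ν') :=
        WDist_rpow_le_of_mem_couplings (by linarith) _ hγ
    _ ≤ ∫⁻ z, 2 ^ (p - 1) * (edist z.1 x₀ ^ p + edist z.2 x₀ ^ p) ∂(ν.prod ν') :=
        lintegral_mono fun z ↦ edist_rpow_le x₀ hp z.1 z.2
    _ = 2 ^ (p - 1) * (∫⁻ x, edist x x₀ ^ p ∂ν + ∫⁻ x, edist x x₀ ^ p ∂ν') := by
        rw [lintegral_const_mul _ h4, lintegral_add_left h2]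
        congr 2
        · conv_rhs => rw [← hγ.1, lintegral_map h1 measurable_fst]
        · conv_rhs => rw [← hγ.2, lintegral_map h1 measurable_snd]

lemma moment_rpow_le (x₀ : E) {p p' : ℝ} (hp : 1 ≤ p) (hpp' : p < p') (μ : Measure E)
    [IsProbabilityMeasure μ] :
    (∫⁻ x, edist x x₀ ^ p ∂μ) ^ (p' / p) ≤ ∫⁻ x, edist x x₀ ^ p' ∂μ := by
  refine (lintegral_rpow_le_lintegral_rpow μ (measurable_edist_rpow x₀ p)
    ((one_lt_div (by linarith)).2 hpp')).trans_eq ?_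
  simp_rw [← ENNReal.rpow_mul]
  rw [mul_div_cancel₀ p' (by linarith)]

lemma memPp_map_of_lintegral_le (x₀ : E) {p p' : ℝ} (hp : 1 ≤ p) (hpp' : p < p')
    (Q : ProbabilityMeasure (ProbabilityMeasure E)) {M : ℝ≥0∞} (hM : M ≠ ∞)
    (hQM : ∫⁻ μ, ∫⁻ x, edist x x₀ ^ p' ∂(μ : Measure E) ∂(Q : Measure (ProbabilityMeasure E)) ≤ M) :
    MemPp p (WDist p edist) ((Q : Measure (ProbabilityMeasure E)).map ProbabilityMeasure.toMeasure) := by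
  have hp0 : 0 < p := by linarith
  have hval : Measurable (ProbabilityMeasure.toMeasure : ProbabilityMeasure E → Measure E) :=
    measurable_subtype_coe
  refine ⟨Measure.isProbabilityMeasure_map hval.aemeasurable, Measure.dirac x₀, ?_⟩
  have hfin : ∫⁻ μ, ∫⁻ x, edist x x₀ ^ p ∂(μ : Measure E)
      ∂(Q : Measure (ProbabilityMeasure E)) ≠ ∞ := by
    have h1 := lintegral_rpow_le_lintegral_rpow (Q : Measure (ProbabilityMeasure E))
      (measurable_moment x₀ p) ((one_lt_div hp0).2 hpp')
    have h2 := (h1.trans (lintegral_mono fun μ ↦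
      moment_rpow_le x₀ hp hpp' (μ : Measure E))).trans hQM
    intro h
    rw [h, ENNReal.top_rpow_of_pos (div_pos (hp0.trans hpp') hp0)] at h2
    exact hM (top_le_iff.1 h2)
  refine ne_top_of_le_ne_top (ENNReal.mul_ne_top (ENNReal.rpow_ne_top_of_nonneg
    (by linarith : 0 ≤ p - 1) (ENNReal.ofNat_ne_top (n := 2))) hfin) ?_
  rw [← lintegral_const_mul _ (measurable_moment x₀ p)]
  refine (lintegral_map_le _ _).trans (lintegral_mono fun μ ↦ ?_)
  refine (WDist_rpow_le x₀ hp (μ : Measure E) (Measure.dirac x₀)).trans_eq ?_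
  rw [lintegral_dirac' _ (measurable_edist_rpow x₀ p), edist_self, ENNReal.zero_rpow_of_pos hp0,
    add_zero]

variable [SecondCountableTopology E]

lemma exists_nhds_forall_WDist_rpow_le (x₀ : E) {p p' : ℝ} (hp : 1 ≤ p) (hpp' : p < p')
    (μ : ProbabilityMeasure E) {R η : ℝ≥0∞} (hR : R ≠ ∞) (hη : η ≠ 0) :
    ∃ V ∈ 𝓝 μ, ∀ ν ∈ V, ∀ ν' ∈ V, ∫⁻ x, edist x x₀ ^ p' ∂(ν : Measure E) ≤ R →
      ∫⁻ x, edist x x₀ ^ p' ∂(ν' : Measure E) ≤ R →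
      WDist p edist (ν : Measure E) (ν' : Measure E) ^ p ≤ η := by
  have hp0 : 0 < p := by linarith
  obtain ⟨W, hW, hWγ⟩ := exists_nhds_forall_exists_coupling_lintegral_le μ
    (D := fun z : E × E ↦ edist z.1 z.2 ^ p) (measurable_edist_rpow x₀ p)
    (measurable_edist_rpow x₀ p') ((one_lt_div hp0).2 hpp') (η := η / 2)
    (fun x ↦ by rw [← ENNReal.rpow_mul, mul_div_cancel₀ p' hp0.ne'])
    (ENNReal.rpow_ne_top_of_nonneg (by linarith) ENNReal.ofNat_ne_top) hR (by simp [hη])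
    (fun z ↦ edist_rpow_le x₀ hp z.1 z.2) fun _ _ x ↦ by
      have hr : 0 < (η / 2) ^ p⁻¹ / 2 := by
        refine ENNReal.div_pos (fun h0 ↦ ?_) ENNReal.ofNat_ne_top
        rw [ENNReal.rpow_eq_zero_iff_of_pos (by positivity)] at h0
        simp [hη] at h0
      refine ⟨Metric.eball x ((η / 2) ^ p⁻¹ / 2), Metric.eball_mem_nhds x hr,
        fun y hy z hz _ _ ↦ ?_⟩
      rw [← ENNReal.le_rpow_inv_iff hp0]
      calc edist y z ≤ edist y x + edist z x := edist_triangle_right y z x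
        _ ≤ (η / 2) ^ p⁻¹ / 2 + (η / 2) ^ p⁻¹ / 2 := add_le_add (le_of_lt hy) (le_of_lt hz)
        _ = (η / 2) ^ p⁻¹ := ENNReal.add_halves _
  refine ⟨W, hW, fun ν hν ν' hν' h h' ↦ ?_⟩
  obtain ⟨γ, hγ, hγη⟩ := hWγ ν hν ν' hν' h h'
  rw [ENNReal.add_halves] at hγη
  exact (WDist_rpow_le_of_mem_couplings hp0 _ hγ).trans hγη

/-- Weak convergence together with bounded moments of order `p' > p` gives convergence in the
iterated `p`-Wasserstein distance. -/
lemma tendsto_WDist_WDist_of_tendsto (x₀ : E) {p p' : ℝ} (hp : 1 ≤ p) (hpp' : p < p')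
    {Q : ℕ → ProbabilityMeasure (ProbabilityMeasure E)}
    {Q' : ProbabilityMeasure (ProbabilityMeasure E)} (hQ : Tendsto Q atTop (𝓝 Q'))
    {M : ℝ≥0∞} (hM : M ≠ ∞) (hQM : ∀ n, ∫⁻ μ, ∫⁻ x, edist x x₀ ^ p' ∂(μ : Measure E)
      ∂(Q n : Measure (ProbabilityMeasure E)) ≤ M) :
    Tendsto (fun n ↦ WDist p (WDist p edist)
      ((Q n : Measure (ProbabilityMeasure E)).map ProbabilityMeasure.toMeasure)
      ((Q' : Measure (ProbabilityMeasure E)).map ProbabilityMeasure.toMeasure)) atTop (𝓝 0) := by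
  have hp0 : 0 < p := by linarith
  have hQ'M := lintegral_moment_le_of_tendsto x₀ (by linarith : 0 ≤ p') hQ hQM
  refine ENNReal.tendsto_nhds_zero.2 fun ε hε ↦ ?_
  have hη : ε ^ p / 2 ≠ 0 := by
    have : ε ^ p ≠ 0 := fun h0 ↦ hε.ne' ((ENNReal.rpow_eq_zero_iff_of_pos hp0).1 h0)
    simp [this]
  obtain ⟨W, hW, hWγ⟩ := exists_nhds_forall_exists_coupling_lintegral_le Q'
    (D := fun z : ProbabilityMeasure E × ProbabilityMeasure E ↦
      WDist p edist (z.1 : Measure E) (z.2 : Measure E) ^ p) (measurable_moment x₀ p)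
    (measurable_moment x₀ p') ((one_lt_div hp0).2 hpp')
    (fun μ ↦ moment_rpow_le x₀ hp hpp' (μ : Measure E))
    (ENNReal.rpow_ne_top_of_nonneg (by linarith) ENNReal.ofNat_ne_top) hM hη
    (fun z ↦ WDist_rpow_le x₀ hp (z.1 : Measure E) (z.2 : Measure E)) fun R hR μ ↦
      exists_nhds_forall_WDist_rpow_le x₀ hp hpp' μ hR hη
  filter_upwards [hQ hW] with n hn
  obtain ⟨γ, hγ, hγε⟩ := hWγ _ hn _ (mem_of_mem_nhds hW) (hQM n) hQ'M
  rw [ENNReal.add_halves] at hγε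
  have hval : Measurable (ProbabilityMeasure.toMeasure : ProbabilityMeasure E → Measure E) :=
    measurable_subtype_coe
  have hval2 : Measurable (Prod.map ProbabilityMeasure.toMeasure ProbabilityMeasure.toMeasure :
      ProbabilityMeasure E × ProbabilityMeasure E → Measure E × Measure E) := hval.prodMap hval
  have hmap : γ.map (Prod.map ProbabilityMeasure.toMeasure ProbabilityMeasure.toMeasure) ∈ Couplings
      ((Q n : Measure (ProbabilityMeasure E)).map ProbabilityMeasure.toMeasure)
      ((Q' : Measure (ProbabilityMeasure E)).map ProbabilityMeasure.toMeasure) := by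
    constructor
    · rw [Measure.map_map measurable_fst hval2, ← hγ.1, Measure.map_map hval measurable_fst]
      rfl
    · rw [Measure.map_map measurable_snd hval2, ← hγ.2, Measure.map_map hval measurable_snd]
      rfl
  exact WDist_le_of_lintegral_le hp0 hmap ((lintegral_map_le _ _).trans hγε)

end Close

section Tight

variable {E : Type*} [TopologicalSpace E] [T2Space E] [NormalSpace E] [MeasurableSpace E]
  [BorelSpace E]

/-- A family of random probability measures whose mean measures are tight is tight. -/
lemma isTightMeasureSet_of_mean [BorelSpace (ProbabilityMeasure E)]
    {T : Set (ProbabilityMeasure (ProbabilityMeasure E))}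
    (hT : ∀ ε : ℝ≥0∞, 0 < ε → ∃ C : Set E, IsCompact C ∧ ∀ Q ∈ T,
      ∫⁻ μ, (μ : Measure E) Cᶜ ∂(Q : Measure (ProbabilityMeasure E)) ≤ ε) :
    IsTightMeasureSet {x | ∃ Q ∈ T, (Q : Measure (ProbabilityMeasure E)) = x} := by
  rw [isTightMeasureSet_iff_exists_isCompact_measure_compl_le]
  intro ε hε
  obtain ⟨ε', hε'0, hε'⟩ := ENNReal.exists_pos_sum_of_countable' hε.ne' ℕ
  set u : ℕ → NNReal := fun n ↦ (1 / 2) ^ n with hu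
  have hu0 : ∀ n, (u n : ℝ≥0∞) ≠ 0 := fun n ↦ by simp [hu]
  have hut : Tendsto u atTop (𝓝 0) := 
    NNReal.tendsto_pow_atTop_nhds_zero_of_lt_one (by norm_num)
  choose C hC hCT using fun n ↦ hT (ε' n * u n) (ENNReal.mul_pos (hε'0 n).ne' (hu0 n))
  refine ⟨_, isCompact_setOfPred_probabilityMeasure_mass_eq_compl_isCompact_le hut hC
    (Or.inl inferInstance), ?_⟩
  rintro _ ⟨Q, hQ, rfl⟩
  have hmeas : ∀ n, Measurable fun μ : ProbabilityMeasure E ↦ (μ : Measure E) (C n)ᶜ := fun n ↦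
    (Measure.measurable_coe (hC n).measurableSet.compl).comp measurable_subtype_coe
  calc (Q : Measure (ProbabilityMeasure E)) {μ | ∀ n, μ (C n)ᶜ ≤ u n}ᶜ
      ≤ (Q : Measure (ProbabilityMeasure E)) (⋃ n, {μ | (u n : ℝ≥0∞) ≤ (μ : Measure E) (C n)ᶜ}) := by
        refine measure_mono fun μ hμ ↦ ?_
        simp only [Set.mem_compl_iff, Set.mem_ofPred_eq, not_forall, not_le] at hμ
        obtain ⟨n, hn⟩ := hμ
        refine Set.mem_iUnion.2 ⟨n, ?_⟩
        rw [Set.mem_ofPred_eq, ← ProbabilityMeasure.ennreal_coeFn_eq_coeFn_toMeasure]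
        exact ENNReal.coe_le_coe.2 hn.le
    _ ≤ ∑' n, (Q : Measure (ProbabilityMeasure E)) {μ | (u n : ℝ≥0∞) ≤ (μ : Measure E) (C n)ᶜ} :=
        measure_iUnion_le _
    _ ≤ ∑' n, ε' n := ENNReal.tsum_le_tsum fun n ↦
        (meas_ge_le_lintegral_div (hmeas n).aemeasurable (hu0 n) ENNReal.coe_ne_top).trans
          (ENNReal.div_le_of_le_mul (hCT n Q hQ))
    _ ≤ ε := hε'.le

end Tight

lemma exists_probabilityMeasure_map_eq {E : Type*} [MeasurableSpace E] (P : Measure (Measure E))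
    [IsProbabilityMeasure P] (hP : ∀ᵐ μ ∂P, IsProbabilityMeasure μ) :
    ∃ Q : ProbabilityMeasure (ProbabilityMeasure E),
      (Q : Measure (ProbabilityMeasure E)).map ProbabilityMeasure.toMeasure = P := by
  have hemb : MeasurableEmbedding (ProbabilityMeasure.toMeasure : ProbabilityMeasure E → Measure E) :=
    MeasurableEmbedding.subtype_coe ProbabilityMeasure.measurableSet_isProbabilityMeasure
  have hmap : (P.comap (ProbabilityMeasure.toMeasure : ProbabilityMeasure E → Measure E)).map
      ProbabilityMeasure.toMeasure = P := by
    rw [hemb.map_comap]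
    exact Measure.restrict_eq_self_of_ae_mem (hP.mono fun μ hμ ↦ ⟨⟨μ, hμ⟩, rfl⟩)
  have hprob : IsProbabilityMeasure
      (P.comap (ProbabilityMeasure.toMeasure : ProbabilityMeasure E → Measure E)) := by
    refine ⟨?_⟩
    rw [← measure_univ (μ := P), ← hmap, Measure.map_apply hemb.measurable MeasurableSet.univ,
      Set.preimage_univ, hmap]
  exact ⟨⟨_, hprob⟩, hmap⟩

/-- **Compactness in `P^p(P^p(E))` (Proposition A.2).**
Let `(E,ℓ)` be a complete separable metric space, `1 ≤ p < p'`. If `K ⊆ P^p(P^p(E))` is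
such that the mean measures `{mP : P ∈ K}` are tight and have uniformly bounded
`p'`-moments, then `K` is relatively compact in `P^p(P^p(E))`.
(Here `mP = P.join` is the mean measure, the level-two Wasserstein distance has the
level-one Wasserstein distance `ℓ_{E,p}` as ground distance, and relative compactness
is stated sequentially.) -/
theorem relCompact_of_meanMeasure_tight
    {E : Type} [MetricSpace E] [CompleteSpace E] [TopologicalSpace.SeparableSpace E]
    [MeasurableSpace E] [BorelSpace E]
    (p p' : ℝ) (hp : 1 ≤ p) (hpp' : p < p')
    (K : Set (Measure (Measure E)))
    (hprob : ∀ P ∈ K, IsProbabilityMeasure P)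
    (hlevel1 : ∀ P ∈ K, ∀ᵐ μ ∂P, MemPp p edist μ)
    (hlevel2 : ∀ P ∈ K, MemPp p (WDist p edist) P)
    (htight : ∀ ε : ℝ≥0∞, 0 < ε → ∃ C : Set E, IsCompact C ∧ ∀ P ∈ K, P.join Cᶜ ≤ ε)
    (hmom : ∃ (x₀ : E) (M : ℝ≥0∞), M ≠ ∞ ∧
      ∀ P ∈ K, ∫⁻ x, edist x x₀ ^ p' ∂(P.join) ≤ M) :
    WRelCompact p (WDist p edist) K := by
  obtain ⟨x₀, M, hM, hKM⟩ := hmom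
  have := UniformSpace.secondCountable_of_separable E
  have hval : Measurable (ProbabilityMeasure.toMeasure : ProbabilityMeasure E → Measure E) :=
    measurable_subtype_coe
  intro Ps hPs
  choose Q hQ using fun n ↦ by
    have := hprob _ (hPs n)
    exact exists_probabilityMeasure_map_eq (Ps n) ((hlevel1 _ (hPs n)).mono fun μ hμ ↦ hμ.1)
  have hQM : ∀ n, ∫⁻ μ, ∫⁻ x, edist x x₀ ^ p' ∂(μ : Measure E)
      ∂(Q n : Measure (ProbabilityMeasure E)) ≤ M := fun n ↦ by
    have h := hKM _ (hPs n)
    rwa [Measure.lintegral_join (measurable_edist_rpow x₀ p').aemeasurable, ← hQ n,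
      lintegral_map (Measure.measurable_lintegral (measurable_edist_rpow x₀ p')) hval] at h
  have hcomp : IsCompact (closure (Set.range Q)) := by
    refine isCompact_closure_of_isTightMeasureSet (isTightMeasureSet_of_mean fun ε hε ↦ ?_)
    obtain ⟨C, hC, hCK⟩ := htight ε hε
    refine ⟨C, hC, ?_⟩
    rintro _ ⟨n, rfl⟩
    have h := hCK _ (hPs n)
    have hCm := hC.measurableSet.compl
    rwa [Measure.join_apply hCm, ← hQ n, lintegral_map (Measure.measurable_coe hCm) hval] at h
  obtain ⟨Q', -, φ, hφ, hQ'⟩ := hcomp.tendsto_subseq fun n ↦ subset_closure (Set.mem_range_self n)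
  refine ⟨φ, (Q' : Measure (ProbabilityMeasure E)).map ProbabilityMeasure.toMeasure, hφ,
    memPp_map_of_lintegral_le x₀ hp hpp' Q' hM
      (lintegral_moment_le_of_tendsto x₀ (by linarith : 0 ≤ p') hQ' fun n ↦ hQM (φ n)), ?_⟩
  have h := tendsto_WDist_WDist_of_tendsto x₀ hp hpp' hQ' hM fun n ↦ hQM (φ n)
  simpa only [WTendsto, Function.comp_apply, hQ] using h

end MFG
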